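/- Let G = (V,A) be a minimally Eulerian digraph with |V| = n > 1. Then there exists an ordering v_1,...,v_n of V and edge-disjoint directed paths P_1,...,P_n decomposing A, such that each P_i is a directed path from v_i to v_{i+1} (indices mod n) of length at most ceil((1/2) * sqrt(n) * (log_2 n)^2). -/

import Mathlib

open scoped Classical

variable {V : Type*}

/-- Outdegree of `v` in the digraph with arc set `A`. -/
noncomputable def outdeg (A : Finset (V × V)) (v : V) : ℕ :=
  (A.filter (fun a => a.1 = v)).card

/-- Indegree of `v` in the digraph with arc set `A`. -/
noncomputable def indeg (A : Finset (V × V)) (v : V) : ℕ :=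
  (A.filter (fun a => a.2 = v)).card

/-- `p_#(G) = (1/2) ∑_v |d⁺(v) - d⁻(v)|`. -/
noncomputable def pSharp [Fintype V] (A : Finset (V × V)) : ℕ :=
  (∑ v, ((outdeg A v : ℤ) - (indeg A v : ℤ)).natAbs) / 2

/-- A (simple) directed path, given as its list of vertices. -/
def IsDipath (A : Finset (V × V)) (l : List V) : Prop :=
  l ≠ [] ∧ l.Nodup ∧ l.Chain' (fun u v => (u, v) ∈ A)

/-- The arc set of a directed path given by its vertex list. -/
noncomputable def pathArcs (l : List V) : Finset (V × V) :=
  (l.zip l.tail).toFinset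

/-- A (simple) directed cycle, given as its list of vertices (the closing
arc from the last vertex back to the first is implicit). -/
def IsDicycle (A : Finset (V × V)) (l : List V) : Prop :=
  2 ≤ l.length ∧ l.Nodup ∧ (l ++ l.take 1).Chain' (fun u v => (u, v) ∈ A)

/-- The arc set of a directed cycle given by its vertex list. -/
noncomputable def cycleArcs (l : List V) : Finset (V × V) :=
  pathArcs (l ++ l.take 1)

/-- A digraph is loopless (simple). -/
def Loopless (A : Finset (V × V)) : Prop := ∀ a ∈ A, a.1 ≠ a.2

/-- A digraph is acyclic if it contains no directed cycle. -/
def Acyclic (A : Finset (V × V)) : Prop := ∀ l : List V, ¬ IsDicycle A l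

/-- Strong connectivity: every vertex reaches every other by a directed walk. -/
def StrongConn (A : Finset (V × V)) : Prop :=
  ∀ u v : V, Relation.ReflTransGen (fun x y => (x, y) ∈ A) u v

/-- A connected Eulerian digraph: strongly connected with balanced degrees. -/
def ConnEuler [Fintype V] (A : Finset (V × V)) : Prop :=
  StrongConn A ∧ ∀ v : V, outdeg A v = indeg A v

/-- Minimally Eulerian: connected Eulerian, and removing the arcs of any
directed cycle disconnects the digraph. -/
def MinEuler [Fintype V] (A : Finset (V × V)) : Prop :=
  ConnEuler A ∧ ∀ l : List V, IsDicycle A l → ¬ StrongConn (A \ cycleArcs l)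

/-- A directed path from `u` to `v`. -/
def IsDipathFrom (A : Finset (V × V)) (u v : V) (l : List V) : Prop :=
  IsDipath A l ∧ l.head? = some u ∧ l.getLast? = some v

/-- The adjacency relation of the `k`-th power: an arc `u → v` whenever
there is a directed path of length at most `k` from `u` to `v`. -/
def powRel (A : Finset (V × V)) (k : ℕ) (u v : V) : Prop :=
  u ≠ v ∧ ∃ l : List V, IsDipathFrom A u v l ∧ l.length ≤ k + 1

/-- Hamiltonicity of (the digraph given by) a relation `R`. -/
def IsHamiltonian (R : V → V → Prop) : Prop :=
  ∃ l : List V, l.Nodup ∧ (∀ v : V, v ∈ l) ∧ 2 ≤ l.length ∧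
    (l ++ l.take 1).Chain' R

/-- The arc traversed at step `i` of the infinite walk `g`. -/
def stepArc (g : ℕ → V) (i : ℕ) : V × V := (g i, g (i + 1))

/-- The vertices visited by `g` at times `a, …, a + d`. -/
def walkSegment (g : ℕ → V) (a d : ℕ) : List V := (List.range' a (d + 1)).map g

lemma walkSegment_zero (g : ℕ → V) (a : ℕ) : walkSegment g a 0 = [g a] := rfl

lemma walkSegment_succ (g : ℕ → V) (a d : ℕ) :
    walkSegment g a (d + 1) = g a :: walkSegment g (a + 1) d := by
  simp [walkSegment, List.range'_succ]

lemma length_walkSegment (g : ℕ → V) (a d : ℕ) : (walkSegment g a d).length = d + 1 := by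
  simp [walkSegment]

lemma head?_walkSegment (g : ℕ → V) (a d : ℕ) : (walkSegment g a d).head? = some (g a) := by
  cases d <;> simp [walkSegment_zero, walkSegment_succ]

lemma getLast?_walkSegment (g : ℕ → V) (a d : ℕ) :
    (walkSegment g a d).getLast? = some (g (a + d)) := by
  simp [walkSegment, List.range'_concat]

lemma isChain_walkSegment {R : V → V → Prop} (g : ℕ → V) (a d : ℕ)
    (h : ∀ i, a ≤ i → i < a + d → R (g i) (g (i + 1))) : (walkSegment g a d).IsChain R := by
  induction d generalizing a with
  | zero => simp [walkSegment_zero]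
  | succ d ih =>
    rw [walkSegment_succ]
    refine List.IsChain.cons (ih (a + 1) fun i h₁ h₂ => h i (by omega) (by omega)) ?_
    intro y hy
    rw [head?_walkSegment] at hy
    cases hy
    exact h a le_rfl (by omega)

lemma nodup_walkSegment (g : ℕ → V) (a d : ℕ) (h : Set.InjOn g (Set.Icc a (a + d))) :
    (walkSegment g a d).Nodup := by
  refine List.Nodup.map_on ?_ List.nodup_range'
  intro x hx y hy hxy
  rw [List.mem_range'_1] at hx hy
  exact h ⟨hx.1, by omega⟩ ⟨hy.1, by omega⟩ hxy

lemma pathArcs_walkSegment (g : ℕ → V) (a d : ℕ) :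
    pathArcs (walkSegment g a d) = (Finset.Ico a (a + d)).image (stepArc g) := by
  induction d generalizing a with
  | zero => simp [walkSegment_zero, pathArcs]
  | succ d ih =>
    have h₁ : pathArcs (walkSegment g a (d + 1)) =
        insert (stepArc g a) (pathArcs (walkSegment g (a + 1) d)) := by
      rw [walkSegment_succ]
      cases d <;> simp [walkSegment_zero, walkSegment_succ, pathArcs, stepArc]
    rw [h₁, ih, show a + 1 + d = a + (d + 1) by omega, ← Finset.image_insert,
      Finset.insert_Ico_add_one_left_eq_Ico (by omega)]

/-- A walk that repeats a vertex contains a directed cycle. -/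
lemma exists_isDicycle_of_repeat {B : Finset (V × V)} (hB : Loopless B) (g : ℕ → V) {a b : ℕ}
    (hg : ∀ i, a ≤ i → i < b → stepArc g i ∈ B)
    (hrep : ∃ j k, a ≤ j ∧ j < k ∧ k ≤ b ∧ g j = g k) :
    ∃ j k l, a ≤ j ∧ j < k ∧ k ≤ b ∧ g j = g k ∧ IsDicycle B l ∧
      cycleArcs l = (Finset.Ico j k).image (stepArc g) := by
  have hex : ∃ k, k ≤ b ∧ ∃ j, a ≤ j ∧ j < k ∧ g j = g k := by
    obtain ⟨j, k, h₁, h₂, h₃, h₄⟩ := hrep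
    exact ⟨k, h₃, j, h₁, h₂, h₄⟩
  obtain ⟨hkb, j, haj, hjk, hgjk⟩ := Nat.find_spec hex
  have hmin := fun m => Nat.find_min (H := hex) (m := m)
  generalize Nat.find hex = k at *
  obtain ⟨d, rfl⟩ : ∃ d, k = j + (d + 1) := ⟨k - j - 1, by omega⟩
  have hd : 1 ≤ d := by
    by_contra hd
    obtain rfl : d = 0 := by omega
    exact hB _ (hg j haj (by omega)) hgjk
  have hcyc : walkSegment g j d ++ (walkSegment g j d).take 1 = walkSegment g j (d + 1) := by
    have h₁ : (walkSegment g j d).take 1 = [g j] := by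
      cases d <;> simp [walkSegment_zero, walkSegment_succ]
    rw [h₁, hgjk]
    simp [walkSegment, List.range'_concat]
  refine ⟨j, j + (d + 1), walkSegment g j d, haj, hjk, hkb, hgjk, ⟨?_, ?_, ?_⟩, ?_⟩
  · rw [length_walkSegment]; omega
  · refine nodup_walkSegment _ _ _ ?_
    intro x hx y hy hxy
    by_contra hne
    simp only [Set.mem_Icc] at hx hy
    rcases lt_or_gt_of_ne hne with h | h
    · exact hmin y (by omega) ⟨by omega, x, by omega, h, hxy⟩
    · exact hmin x (by omega) ⟨by omega, y, by omega, h, hxy.symm⟩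
  · rw [hcyc]
    exact isChain_walkSegment _ _ _ fun i h₁ h₂ => hg i (by omega) (by omega)
  · rw [cycleArcs, hcyc, pathArcs_walkSegment]

/-- A walk of `k` steps in `A` along pairwise distinct arcs. -/
def IsTrail (A : Finset (V × V)) (k : ℕ) (g : ℕ → V) : Prop :=
  (∀ i < k, stepArc g i ∈ A) ∧ Set.InjOn (stepArc g) (Finset.range k)

/-- An Eulerian circuit of length `M`, seen as a periodic sequence of vertices. -/
structure IsEulerTour (A : Finset (V × V)) (M : ℕ) (g : ℕ → V) : Prop where
  pos : 0 < M
  periodic : Function.Periodic g M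
  injOn : Set.InjOn (stepArc g) (Finset.range M)
  image_eq : (Finset.range M).image (stepArc g) = A

lemma IsTrail.image_subset {A : Finset (V × V)} {k : ℕ} {g : ℕ → V} (h : IsTrail A k g) :
    (Finset.range k).image (stepArc g) ⊆ A := by
  intro a ha
  obtain ⟨i, hi, rfl⟩ := Finset.mem_image.1 ha
  exact h.1 i (Finset.mem_range.1 hi)

lemma IsTrail.le_card {A : Finset (V × V)} {k : ℕ} {g : ℕ → V} (h : IsTrail A k g) :
    k ≤ A.card := by
  have := Finset.card_le_card h.image_subset
  rwa [Finset.card_image_of_injOn h.2, Finset.card_range] at this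

/-- A trail can be prolonged along an arc it has not used. -/
lemma IsTrail.extend {A : Finset (V × V)} {k : ℕ} {g : ℕ → V} (h : IsTrail A k g) {y : V}
    (hy : (g k, y) ∈ A) (hnew : (g k, y) ∉ (Finset.range k).image (stepArc g)) :
    ∃ g', IsTrail A (k + 1) g' := by
  set g' : ℕ → V := fun i => if i ≤ k then g i else y
  have hlt : ∀ i < k, stepArc g' i = stepArc g i := by
    intro i hi
    simp [g', stepArc, hi.le, Nat.succ_le_of_lt hi]
  have hk : stepArc g' k = (g k, y) := by simp [g', stepArc]
  refine ⟨g', ?_, ?_⟩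
  · intro i hi
    rcases Nat.lt_succ_iff_lt_or_eq.1 hi with hi | rfl
    · rw [hlt i hi]; exact h.1 i hi
    · rw [hk]; exact hy
  · have hne : ∀ i < k, stepArc g i ≠ (g k, y) := fun i hi he =>
      hnew (Finset.mem_image.2 ⟨i, Finset.mem_range.2 hi, he⟩)
    intro i hi j hj hij
    simp only [Finset.coe_range, Set.mem_Iio] at hi hj
    rcases Nat.lt_succ_iff_lt_or_eq.1 hi with hi | rfl <;>
      rcases Nat.lt_succ_iff_lt_or_eq.1 hj with hj | rfl
    · rw [hlt i hi, hlt j hj] at hij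
      exact h.2 (by simpa using hi) (by simpa using hj) hij
    · rw [hlt i hi, hk] at hij
      exact absurd hij (hne i hi)
    · rw [hlt j hj, hk] at hij
      exact absurd hij.symm (hne j hj)
    · rfl

/-- In a balanced digraph, a trail using every arc out of its last vertex is closed. -/
lemma IsTrail.closed {A : Finset (V × V)} {k : ℕ} {g : ℕ → V} (h : IsTrail A k g)
    (hbal : outdeg A (g k) = indeg A (g k))
    (hout : ∀ y, (g k, y) ∈ A → (g k, y) ∈ (Finset.range k).image (stepArc g)) :
    g 0 = g k := by
  by_contra hne
  obtain ⟨w, hw⟩ : ∃ w, g k = w := ⟨_, rfl⟩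
  rw [hw] at hbal hne
  simp only [hw] at hout
  have h_out : outdeg A w ≤ ((Finset.range k).filter fun i => g i = w).card := by
    refine (Finset.card_le_card (t := ((Finset.range k).filter fun i => g i = w).image
      (stepArc g)) ?_).trans Finset.card_image_le
    rintro ⟨x, y⟩ hxy
    obtain ⟨hmem, rfl : x = w⟩ := Finset.mem_filter.1 hxy
    obtain ⟨i, hi, he⟩ := Finset.mem_image.1 (hout y hmem)
    exact Finset.mem_image.2 ⟨i, Finset.mem_filter.2 ⟨hi, congrArg Prod.fst he⟩, he⟩
  have h_in : ((Finset.range k).filter fun i => g (i + 1) = w).card ≤ indeg A w := by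
    refine Finset.card_le_card_of_injOn (stepArc g) ?_ (h.2.mono ?_)
    · intro i hi
      obtain ⟨hi, he⟩ := Finset.mem_filter.1 hi
      exact Finset.mem_filter.2 ⟨h.1 i (Finset.mem_range.1 hi), he⟩
    · exact Finset.coe_subset.2 (Finset.filter_subset _ _)
  have hsum : ((Finset.range k).filter fun i => g i = w).card + 1 =
      ((Finset.range k).filter fun i => g (i + 1) = w).card := by
    have h₁ := Finset.sum_range_succ (fun i => if g i = w then 1 else 0) k
    have h₂ := Finset.sum_range_succ' (fun i => if g i = w then 1 else 0) k
    rw [h₁, if_pos hw, if_neg hne, add_zero] at h₂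
    rwa [Finset.card_filter, Finset.card_filter]
  omega

lemma ConnEuler.exists_tour [Fintype V] {A : Finset (V × V)} (h : ConnEuler A)
    (hne : A.Nonempty) : ∃ M g, IsEulerTour A M g := by
  obtain ⟨k, ⟨g, hg⟩, hmax⟩ : ∃ k, (∃ g, IsTrail A k g) ∧ ¬ ∃ g, IsTrail A (k + 1) g := by
    by_contra! hcon
    have hall : ∀ k, ∃ g, IsTrail A k g := by
      intro k
      induction k with
      | zero =>
        obtain ⟨a, -⟩ := hne
        exact ⟨fun _ => a.1, by simp [IsTrail]⟩
      | succ k ih =>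
        by_contra! hk
        obtain ⟨g, hg⟩ := hcon k ih
        exact hk g hg
    obtain ⟨g, hg⟩ := hall (A.card + 1)
    have := hg.le_card
    omega
  have hk : 0 < k := by
    rcases Nat.eq_zero_or_pos k with rfl | hk
    · obtain ⟨⟨x, y⟩, ha⟩ := hne
      refine absurd ?_ hmax
      exact IsTrail.extend (g := fun _ => x) (y := y) (k := 0) (by simp [IsTrail]) ha (by simp)
    · exact hk
  have hclosed : g 0 = g k := by
    refine hg.closed (h.2 _) ?_
    intro y hy
    by_contra hnew
    exact hmax (hg.extend hy hnew)
  set p : ℕ → V := fun i => g (i % k)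
  have hper : Function.Periodic p k := fun i => by simp [p]
  have hp : ∀ i < k, stepArc p i = stepArc g i := by
    intro i hi
    rcases (show i + 1 ≤ k by omega).lt_or_eq with h' | h'
    · simp [p, stepArc, Nat.mod_eq_of_lt hi, Nat.mod_eq_of_lt h']
    · simp [p, stepArc, Nat.mod_eq_of_lt hi, h', hclosed]
  have hpm : ∀ i, stepArc p i = stepArc g (i % k) := by
    intro i
    rw [← hp _ (Nat.mod_lt i hk)]
    simp only [stepArc, p, Nat.mod_mod, Nat.mod_add_mod]
  have hrot : ∀ j, IsTrail A k fun i => p (j + i) := by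
    intro j
    have hs : ∀ i, stepArc (fun i => p (j + i)) i = stepArc g ((j + i) % k) :=
      fun i => hpm (j + i)
    refine ⟨fun i _ => by rw [hs]; exact hg.1 _ (Nat.mod_lt _ hk), ?_⟩
    intro a ha b hb hab
    simp only [Finset.coe_range, Set.mem_Iio] at ha hb
    rw [hs, hs] at hab
    have h₁ : (j + a) % k = (j + b) % k :=
      hg.2 (by simpa using Nat.mod_lt _ hk) (by simpa using Nat.mod_lt _ hk) hab
    exact Nat.ModEq.eq_of_lt_of_lt (Nat.ModEq.add_left_cancel' j h₁) ha hb
  have hused : ∀ j y, (p j, y) ∈ A → (p j, y) ∈ (Finset.range k).image (stepArc p) := by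
    intro j y hy
    by_contra hnew
    have hjk : p (j + k) = p j := hper j
    refine hmax ((hrot j).extend (y := y) (by simpa only [hjk] using hy) ?_)
    simp only [hjk]
    intro hmem
    refine hnew ?_
    obtain ⟨i, -, hi⟩ := Finset.mem_image.1 hmem
    refine Finset.mem_image.2 ⟨(j + i) % k, Finset.mem_range.2 (Nat.mod_lt _ hk), ?_⟩
    rw [← hi, hpm, Nat.mod_mod]
    exact (hpm (j + i)).symm
  have hvis : ∀ v, ∃ j, p j = v := by
    intro v
    induction h.1 (p 0) v with
    | refl => exact ⟨0, rfl⟩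
    | tail _ hbc ih =>
      obtain ⟨j, rfl⟩ := ih
      obtain ⟨i, -, hi⟩ := Finset.mem_image.1 (hused j _ hbc)
      exact ⟨i + 1, congrArg Prod.snd hi⟩
  have hp₀ : IsTrail A k p := by
    have := hrot 0
    simp only [Nat.zero_add] at this
    exact this
  refine ⟨k, p, hk, hper, hp₀.2, subset_antisymm hp₀.image_subset ?_⟩
  rintro ⟨x, y⟩ ha
  obtain ⟨j, rfl⟩ := hvis x
  exact hused j y ha

namespace IsEulerTour

variable {A : Finset (V × V)} {M : ℕ} {g : ℕ → V}

lemma stepArc_add (h : IsEulerTour A M g) (i : ℕ) : stepArc g (i + M) = stepArc g i := by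
  simp only [stepArc, h.periodic i, show i + M + 1 = i + 1 + M by omega, h.periodic (i + 1)]

lemma stepArc_mod (h : IsEulerTour A M g) (i : ℕ) : stepArc g (i % M) = stepArc g i :=
  Function.Periodic.map_mod_nat (f := stepArc g) h.stepArc_add i

lemma injOn_Ico (h : IsEulerTour A M g) (a : ℕ) :
    Set.InjOn (stepArc g) (Set.Ico a (a + M)) := by
  intro i hi j hj hij
  rw [← h.stepArc_mod i, ← h.stepArc_mod j] at hij
  have h₁ : i % M = j % M :=
    h.injOn (by simpa using Nat.mod_lt _ h.pos) (by simpa using Nat.mod_lt _ h.pos) hij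
  obtain ⟨x, rfl⟩ := Nat.exists_eq_add_of_le hi.1
  obtain ⟨y, rfl⟩ := Nat.exists_eq_add_of_le hj.1
  have h₂ : x = y := Nat.ModEq.eq_of_lt_of_lt (Nat.ModEq.add_left_cancel' a h₁)
    (by have := hi.2; omega) (by have := hj.2; omega)
  rw [h₂]

lemma stepArc_mem (h : IsEulerTour A M g) (i : ℕ) : stepArc g i ∈ A := by
  rw [← h.stepArc_mod, ← h.image_eq]
  exact Finset.mem_image_of_mem _ (Finset.mem_range.2 (Nat.mod_lt _ h.pos))

lemma image_Ico (h : IsEulerTour A M g) (a : ℕ) :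
    (Finset.Ico a (a + M)).image (stepArc g) = A := by
  refine Finset.eq_of_subset_of_card_le ?_ ?_
  · intro x hx
    obtain ⟨i, -, rfl⟩ := Finset.mem_image.1 hx
    exact h.stepArc_mem i
  · rw [Finset.card_image_of_injOn (by simpa using h.injOn_Ico a)]
    conv_lhs => rw [← h.image_eq]
    exact Finset.card_image_le.trans (by simp)

lemma exists_visit (h : IsEulerTour A M g) (hA : StrongConn A) (v : V) : ∃ i < M, g i = v := by
  obtain ⟨j, rfl⟩ : ∃ j, g j = v := by
    induction hA (g 0) v with
    | refl => exact ⟨0, rfl⟩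
    | tail _ hbc _ =>
      rw [← h.image_eq] at hbc
      obtain ⟨i, -, hi⟩ := Finset.mem_image.1 hbc
      exact ⟨i + 1, congrArg Prod.snd hi⟩
  exact ⟨j % M, Nat.mod_lt _ h.pos, h.periodic.map_mod_nat j⟩

/-- Any potential has total variation zero along an Eulerian circuit. -/
lemma sum_sub_eq_zero (h : IsEulerTour A M g) (ρ : V → ℤ) : ∑ a ∈ A, (ρ a.2 - ρ a.1) = 0 := by
  have h₁ : ∑ i ∈ Finset.range M, (ρ (g (i + 1)) - ρ (g i)) = 0 := by
    rw [Finset.sum_range_sub fun i => ρ (g i)]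
    simp [h.periodic.eq]
  rw [← h.image_eq, Finset.sum_image h.injOn]
  exact h₁

lemma reachable_of_le {B : Finset (V × V)} {x y : ℕ} (hxy : x ≤ y)
    (hB : ∀ i, x ≤ i → i < y → stepArc g i ∈ B) :
    Relation.ReflTransGen (fun u v => (u, v) ∈ B) (g x) (g y) := by
  induction y, hxy using Nat.le_induction with
  | base => exact .refl
  | succ y hxy ih => exact (ih fun i h₁ h₂ => hB i h₁ (by omega)).tail (hB y hxy (by omega))

/-- In a minimally Eulerian digraph, a segment of an Eulerian circuit whose complement visits
every vertex is a simple path. -/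
lemma injOn_segment (h : IsEulerTour A M g) (hloop : Loopless A)
    (hmin : ∀ l : List V, IsDicycle A l → ¬ StrongConn (A \ cycleArcs l)) {a b : ℕ}
    (hvis : ∀ v, ∃ p, g p = v ∧ b ≤ p ∧ p ≤ a + M) : Set.InjOn g (Set.Icc a b) := by
  by_contra hinj
  have hrep : ∃ j k, a ≤ j ∧ j < k ∧ k ≤ b ∧ g j = g k := by
    simp only [Set.InjOn, not_forall] at hinj
    obtain ⟨x, hx, y, hy, hxy, hne⟩ := hinj
    rcases lt_or_gt_of_ne hne with hlt | hlt
    · exact ⟨x, y, hx.1, hlt, hy.2, hxy⟩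
    · exact ⟨y, x, hy.1, hlt, hx.2, hxy.symm⟩
  obtain ⟨j, k, l, haj, hjk, hkb, hgjk, hl, harcs⟩ :=
    exists_isDicycle_of_repeat hloop g (fun i _ _ => h.stepArc_mem i) hrep
  refine hmin l hl ?_
  have hB : ∀ i, k ≤ i → i < j + M → stepArc g i ∈ A \ cycleArcs l := by
    intro i h₁ h₂
    refine Finset.mem_sdiff.2 ⟨h.stepArc_mem i, ?_⟩
    rw [harcs]
    intro hmem
    obtain ⟨i', hi', he⟩ := Finset.mem_image.1 hmem
    rw [Finset.mem_Ico] at hi'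
    have := h.injOn_Ico j ⟨hi'.1, by omega⟩ ⟨by omega, h₂⟩ he
    omega
  intro u v
  obtain ⟨p, rfl, hp₁, hp₂⟩ := hvis u
  obtain ⟨p', rfl, hp₁', hp₂'⟩ := hvis v
  have hto := reachable_of_le (g := g) (show p ≤ j + M by omega)
    fun i h₁ h₂ => hB i (by omega) h₂
  have hfrom := reachable_of_le (g := g) (show k ≤ p' by omega)
    fun i h₁ h₂ => hB i h₁ (by omega)
  rw [h.periodic j, hgjk] at hto
  exact hto.trans hfrom

/-- The arcs by which a tour leaves each vertex for the last time, together with those by which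
it reaches each vertex for the first time, form a sparse strongly connected spanning subgraph. -/
lemma exists_sparse_strongConn [Fintype V] (h : IsEulerTour A M g) (hA : StrongConn A) :
    ∃ T ⊆ A, StrongConn T ∧ T.card ≤ 2 * Fintype.card V ∧
      ∀ U : Finset V, (T.filter fun a => a.1 ∈ U ∧ a.2 ∈ U).card ≤ 2 * U.card := by
  have hlast : ∀ v, ∃ p < M, g p = v ∧ ∀ p' < M, g p' = v → p' ≤ p := by
    intro v
    obtain ⟨i, hi, hgi⟩ := h.exists_visit hA v
    obtain ⟨p, hp, hmax⟩ := Finset.exists_max_image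
      ((Finset.range M).filter fun p => g p = v) id ⟨i, by simp [hi, hgi]⟩
    simp only [Finset.mem_filter, Finset.mem_range, id, and_imp] at hp hmax
    exact ⟨p, hp.1, hp.2, hmax⟩
  have hfirst : ∀ v, ∃ p < M, g (p + 1) = v ∧ ∀ p' < M, g (p' + 1) = v → p ≤ p' := by
    intro v
    obtain ⟨i, hi, hgi⟩ : ∃ i < M, g (i + 1) = v := by
      obtain ⟨i, hi, hgi⟩ := h.exists_visit hA v
      rcases Nat.eq_zero_or_pos i with rfl | hpos
      · refine ⟨M - 1, by omega, ?_⟩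
        rw [Nat.sub_add_cancel hi, h.periodic.eq, hgi]
      · exact ⟨i - 1, by omega, by rw [Nat.sub_add_cancel hpos, hgi]⟩
    obtain ⟨p, hp, hmin⟩ := Finset.exists_min_image
      ((Finset.range M).filter fun p => g (p + 1) = v) id ⟨i, by simp [hi, hgi]⟩
    simp only [Finset.mem_filter, Finset.mem_range, id, and_imp] at hp hmin
    exact ⟨p, hp.1, hp.2, hmin⟩
  choose last hlast_lt hlast_eq hlast_max using hlast
  choose first hfirst_lt hfirst_eq hfirst_min using hfirst
  set T : Finset (V × V) := Finset.univ.image (fun v => stepArc g (last v)) ∪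
    Finset.univ.image (fun v => stepArc g (first v))
  have hlast_mem : ∀ v, stepArc g (last v) ∈ T := fun v =>
    Finset.mem_union_left _ (Finset.mem_image_of_mem _ (Finset.mem_univ v))
  have hfirst_mem : ∀ v, stepArc g (first v) ∈ T := fun v =>
    Finset.mem_union_right _ (Finset.mem_image_of_mem _ (Finset.mem_univ v))
  refine ⟨T, ?_, ?_, ?_, ?_⟩
  · intro a ha
    rcases Finset.mem_union.1 ha with ha | ha <;>
    · obtain ⟨v, -, rfl⟩ := Finset.mem_image.1 ha
      exact h.stepArc_mem _
  · have hto : ∀ d p, p + d = M →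
        Relation.ReflTransGen (fun u v => (u, v) ∈ T) (g p) (g 0) := by
      intro d
      induction d using Nat.strong_induction_on with
      | _ d ih =>
        intro p hp
        rcases Nat.eq_zero_or_pos d with rfl | hd
        · rw [show p = M by omega, h.periodic.eq]
        · have h₁ := hlast_max (g p) p (by omega) rfl
          have h₂ := hlast_lt (g p)
          have h₃ := hlast_mem (g p)
          rw [stepArc, hlast_eq] at h₃
          exact .head h₃ (ih (M - (last (g p) + 1)) (by omega) _ (by omega))
    have hfrom : ∀ p ≤ M, Relation.ReflTransGen (fun u v => (u, v) ∈ T) (g 0) (g p) := by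
      intro p
      induction p using Nat.strong_induction_on with
      | _ p ih =>
        intro hp
        rcases Nat.eq_zero_or_pos p with rfl | hd
        · exact .refl
        · have h₁ := hfirst_min (g p) (p - 1) (by omega) (by rw [Nat.sub_add_cancel hd])
          have h₃ := hfirst_mem (g p)
          rw [stepArc, hfirst_eq] at h₃
          exact (ih (first (g p)) (by omega) (by omega)).tail h₃
    intro u v
    obtain ⟨i, hi, rfl⟩ := h.exists_visit hA u
    obtain ⟨j, hj, rfl⟩ := h.exists_visit hA v
    exact (hto (M - i) i (by omega)).trans (hfrom j hj.le)
  · refine (Finset.card_union_le _ _).trans ?_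
    have h₁ := Finset.card_image_le (s := Finset.univ) (f := fun v => stepArc g (last v))
    have h₂ := Finset.card_image_le (s := Finset.univ) (f := fun v => stepArc g (first v))
    rw [Finset.card_univ] at h₁ h₂
    omega
  · intro U
    have hsub : (T.filter fun a => a.1 ∈ U ∧ a.2 ∈ U) ⊆
        U.image (fun v => stepArc g (last v)) ∪ U.image (fun v => stepArc g (first v)) := by
      intro a ha
      obtain ⟨ha, h₁, h₂⟩ := Finset.mem_filter.1 ha
      rcases Finset.mem_union.1 ha with ha | ha
      · obtain ⟨v, -, rfl⟩ := Finset.mem_image.1 ha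
        rw [stepArc, hlast_eq] at h₁
        exact Finset.mem_union_left _ (Finset.mem_image_of_mem _ h₁)
      · obtain ⟨v, -, rfl⟩ := Finset.mem_image.1 ha
        rw [stepArc, hfirst_eq] at h₂
        exact Finset.mem_union_right _ (Finset.mem_image_of_mem _ h₂)
    refine (Finset.card_le_card hsub).trans ((Finset.card_union_le _ _).trans ?_)
    have h₁ := Finset.card_image_le (s := U) (f := fun v => stepArc g (last v))
    have h₂ := Finset.card_image_le (s := U) (f := fun v => stepArc g (first v))
    omega

end IsEulerTour

lemma IsDicycle.mono {A B : Finset (V × V)} (hAB : A ⊆ B) {l : List V} (h : IsDicycle A l) :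
    IsDicycle B l :=
  ⟨h.1, h.2.1, h.2.2.imp fun _ _ h => hAB h⟩

lemma IsDicycle.cycleArcs_subset {A : Finset (V × V)} {l : List V} (h : IsDicycle A l) :
    cycleArcs l ⊆ A := by
  have key : ∀ l : List V, l.IsChain (fun u v => (u, v) ∈ A) → pathArcs l ⊆ A := by
    intro l hl
    induction l with
    | nil => simp [pathArcs]
    | cons x l ih =>
      cases l with
      | nil => simp [pathArcs]
      | cons y l =>
        rw [List.isChain_cons_cons] at hl
        have := ih hl.2
        simp only [pathArcs, List.tail_cons, List.zip_cons_cons, List.toFinset_cons] at this ⊢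
        exact Finset.insert_subset hl.1 this
  exact key _ h.2.2

/-- A topological order: the arcs of an acyclic digraph decrease along some linear order. -/
lemma Acyclic.exists_wellOrder [Finite V] {D : Finset (V × V)} (hloop : Loopless D)
    (hD : Acyclic D) :
    ∃ s : V → V → Prop, IsWellOrder V s ∧ ∀ a ∈ D, s a.2 a.1 := by
  have hwf : WellFounded fun x y : V => (y, x) ∈ D := by
    rw [wellFounded_iff_isEmpty_descending_chain]
    refine ⟨fun ⟨f, hf⟩ => ?_⟩
    obtain ⟨i, j, hij, he⟩ := Finite.exists_ne_map_eq_of_infinite f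
    have hrep : ∃ j' k, 0 ≤ j' ∧ j' < k ∧ k ≤ max i j ∧ f j' = f k := by
      rcases lt_or_gt_of_ne hij with hlt | hlt
      · exact ⟨i, j, Nat.zero_le _, hlt, le_max_right _ _, he⟩
      · exact ⟨j, i, Nat.zero_le _, hlt, le_max_left _ _, he.symm⟩
    obtain ⟨-, -, l, -, -, -, -, hl, -⟩ :=
      exists_isDicycle_of_repeat hloop f (fun i _ _ => hf i) hrep
    exact hD l hl
  have : IsWellFounded V fun x y => (y, x) ∈ D := ⟨hwf⟩
  obtain ⟨s, hs, hwo⟩ := IsWellFounded.exists_well_order_ge fun x y : V => (y, x) ∈ D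
  exact ⟨s, hwo, fun a ha => hs _ _ ha⟩

/-- An acyclic digraph admits a potential with values in `0, …, |U|` that weakly increases along
arcs, strictly so along arcs leaving `U`, and is injective on `U`. -/
lemma Acyclic.exists_potential [Finite V] {D : Finset (V × V)} (hloop : Loopless D)
    (hD : Acyclic D) (U : Finset V) :
    ∃ ρ : V → ℕ, (∀ v, ρ v ≤ U.card) ∧ (∀ a ∈ D, ρ a.1 ≤ ρ a.2) ∧
      (∀ a ∈ D, a.1 ∈ U → ρ a.1 < ρ a.2) ∧ Set.InjOn ρ U := by
  obtain ⟨s, hs, hD⟩ := hD.exists_wellOrder hloop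
  have hle : ∀ x y, s y x → U.filter (s x) ⊆ U.filter (s y) := fun x y hyx =>
    Finset.monotone_filter_right U fun u _ hu => _root_.trans hyx hu
  have hlt : ∀ x y, s y x → x ∈ U → (U.filter (s x)).card < (U.filter (s y)).card := by
    intro x y hyx hx
    refine Finset.card_lt_card ((Finset.ssubset_iff_of_subset (hle x y hyx)).2
      ⟨x, by simp [hx, hyx], by simp [irrefl]⟩)
  refine ⟨fun v => (U.filter (s v)).card, fun v => Finset.card_filter_le _ _,
    fun a ha => Finset.card_le_card (hle _ _ (hD a ha)), fun a ha => hlt _ _ (hD a ha), ?_⟩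
  intro x hx y hy hxy
  rcases trichotomous_of s x y with h | h | h
  · exact absurd hxy (hlt y x h hy).ne'
  · exact h
  · exact absurd hxy (hlt x y h hx).ne

/-- Induced subgraphs of minimally Eulerian digraphs on at most `(s + 1) ^ 2` vertices have
at most `3 s + 4` arcs per vertex. -/
lemma MinEuler.card_induced_le [Fintype V] {A : Finset (V × V)} (hloop : Loopless A)
    (h : MinEuler A) {M : ℕ} {g : ℕ → V} (hg : IsEulerTour A M g) {s : ℕ}
    (hs : Fintype.card V ≤ (s + 1) ^ 2) (U : Finset V) :
    (A.filter fun a => a.1 ∈ U ∧ a.2 ∈ U).card ≤ U.card * (3 * s + 4) := by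
  obtain ⟨T, hTA, hT, hTcard, hTU⟩ := hg.exists_sparse_strongConn h.1.1
  have hacyc : Acyclic (A \ T) := by
    intro l hl
    refine h.2 l (hl.mono Finset.sdiff_subset) fun u v =>
      Relation.ReflTransGen.mono (fun x y hxy => ?_) u v (hT u v)
    exact Finset.mem_sdiff.2 ⟨hTA hxy, fun hc =>
      (Finset.mem_sdiff.1 (hl.cycleArcs_subset hc)).2 hxy⟩
  obtain ⟨ρ, hρU, hρle, hρlt, hρinj⟩ := hacyc.exists_potential
    (fun a ha => hloop a (Finset.sdiff_subset ha)) U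
  set m := U.card
  set D := (A \ T).filter fun a => a.1 ∈ U ∧ a.2 ∈ U
  have hsum : ∑ a ∈ D, ((ρ a.2 : ℤ) - ρ a.1) ≤ 2 * Fintype.card V * m := by
    have h₀ := hg.sum_sub_eq_zero fun v => (ρ v : ℤ)
    rw [← Finset.sum_sdiff hTA] at h₀
    have h₁ : ∑ a ∈ T, ((ρ a.1 : ℤ) - ρ a.2) ≤ T.card * m := by
      rw [← nsmul_eq_mul]
      refine Finset.sum_le_card_nsmul _ _ _ fun a _ => ?_
      have := hρU a.1
      omega
    have h₂ : ∑ a ∈ T, ((ρ a.1 : ℤ) - ρ a.2) = -∑ a ∈ T, ((ρ a.2 : ℤ) - ρ a.1) := by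
      rw [← Finset.sum_neg_distrib]
      exact Finset.sum_congr rfl fun a _ => by ring
    have h₃ : ∑ a ∈ D, ((ρ a.2 : ℤ) - ρ a.1) ≤ ∑ a ∈ A \ T, ((ρ a.2 : ℤ) - ρ a.1) := by
      refine Finset.sum_le_sum_of_subset_of_nonneg (Finset.filter_subset _ _) fun a ha _ => ?_
      have := hρle a ha
      omega
    have h₄ : (T.card : ℤ) * m ≤ 2 * Fintype.card V * m := by
      exact_mod_cast Nat.mul_le_mul_right m hTcard
    linarith
  have hshort : (D.filter fun a => ρ a.2 ≤ ρ a.1 + s).card ≤ m * s := by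
    rw [show m * s = (U ×ˢ Finset.range s).card by simp [m]]
    refine Finset.card_le_card_of_injOn (fun a => (a.1, ρ a.2 - ρ a.1 - 1)) ?_ ?_
    · intro a ha
      obtain ⟨haD, has⟩ := Finset.mem_filter.1 ha
      obtain ⟨hmem, h₁, h₂⟩ := Finset.mem_filter.1 haD
      have := hρlt a hmem h₁
      simp only [Finset.coe_product, Set.mem_prod, Finset.mem_coe, Finset.mem_range]
      exact ⟨h₁, by omega⟩
    · rintro ⟨x, y⟩ ha ⟨x', y'⟩ hb hab
      obtain ⟨haD, has⟩ := Finset.mem_filter.1 ha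
      obtain ⟨hmem, h₁, h₂⟩ := Finset.mem_filter.1 haD
      obtain ⟨hbD, hbs⟩ := Finset.mem_filter.1 hb
      obtain ⟨hmem', h₁', h₂'⟩ := Finset.mem_filter.1 hbD
      have h₃ := hρlt _ hmem h₁
      have h₄ := hρlt _ hmem' h₁'
      simp only [Prod.mk.injEq] at hab h₃ h₄ ⊢
      obtain ⟨rfl, hab⟩ := hab
      exact ⟨rfl, hρinj h₂ h₂' (by simp only; omega)⟩
  have hlong : (D.filter fun a => ¬ ρ a.2 ≤ ρ a.1 + s).card ≤ m * (2 * (s + 1)) := by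
    set E := D.filter fun a => ¬ ρ a.2 ≤ ρ a.1 + s
    have h₁ : (E.card : ℤ) * (s + 1) ≤ ∑ a ∈ E, ((ρ a.2 : ℤ) - ρ a.1) := by
      rw [← nsmul_eq_mul]
      refine Finset.card_nsmul_le_sum _ _ _ fun a ha => ?_
      have := (Finset.mem_filter.1 ha).2
      omega
    have h₂ : ∑ a ∈ E, ((ρ a.2 : ℤ) - ρ a.1) ≤ ∑ a ∈ D, ((ρ a.2 : ℤ) - ρ a.1) := by
      refine Finset.sum_le_sum_of_subset_of_nonneg (Finset.filter_subset _ _) fun a ha _ => ?_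
      have := hρle a (Finset.mem_filter.1 ha).1
      omega
    have h₃ : E.card * (s + 1) ≤ 2 * Fintype.card V * m := by
      exact_mod_cast h₁.trans (h₂.trans hsum)
    refine Nat.le_of_mul_le_mul_right (c := s + 1) ?_ (Nat.succ_pos s)
    nlinarith [Nat.mul_le_mul_right m hs]
  have hsplit : (A.filter fun a => a.1 ∈ U ∧ a.2 ∈ U).card ≤
      (T.filter fun a => a.1 ∈ U ∧ a.2 ∈ U).card + D.card := by
    refine (Finset.card_le_card ?_).trans (Finset.card_union_le _ _)
    rw [← Finset.filter_union, Finset.union_sdiff_of_subset hTA]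
  have hD := Finset.card_filter_add_card_filter_not (s := D) fun a => ρ a.2 ≤ ρ a.1 + s
  have := hTU U
  nlinarith

/-- Every window of `3 s + 5` consecutive steps of an Eulerian circuit can be assigned one of the
vertices visited in it, distinct windows receiving distinct vertices. -/
lemma MinEuler.exists_window_transversal [Fintype V] {A : Finset (V × V)} (hloop : Loopless A)
    (h : MinEuler A) {M : ℕ} {g : ℕ → V} (hg : IsEulerTour A M g) {s : ℕ}
    (hs : Fintype.card V ≤ (s + 1) ^ 2) :
    ∃ φ : Fin (M / (3 * s + 5)) → V, Function.Injective φ ∧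
      ∀ w : Fin (M / (3 * s + 5)), ∃ i < 3 * s + 5, g (w * (3 * s + 5) + i) = φ w := by
  set L := 3 * s + 5
  set visited : Fin (M / L) → Finset V := fun w =>
    (Finset.range L).image fun i => g (w * L + i)
  obtain ⟨φ, hφ, hmem⟩ :=
    (Finset.all_card_le_biUnion_card_iff_exists_injective visited).1 fun S => by
      set U := S.biUnion visited
      have hU : ∀ w ∈ S, ∀ i < L, g (w * L + i) ∈ U := fun w hw i hi =>
        Finset.mem_biUnion.2 ⟨w, hw, Finset.mem_image_of_mem _ (Finset.mem_range.2 hi)⟩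
      have hcard : (S ×ˢ Finset.range (3 * s + 4)).card ≤
          (A.filter fun a => a.1 ∈ U ∧ a.2 ∈ U).card := by
        refine Finset.card_le_card_of_injOn (fun x => stepArc g (x.1 * L + x.2)) ?_ ?_
        · intro x hx
          obtain ⟨hx₁, hx₂⟩ := Finset.mem_product.1 hx
          rw [Finset.mem_range] at hx₂
          exact Finset.mem_filter.2 ⟨hg.stepArc_mem _, hU _ hx₁ _ (by omega),
            hU _ hx₁ (x.2 + 1) (by omega)⟩
        · have hlt : ∀ (w : Fin (M / L)) i, i < 3 * s + 4 → w * L + i < M := by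
            intro w i hi
            have h₁ : (w + 1) * L ≤ M / L * L := Nat.mul_le_mul_right L w.2
            have h₂ := Nat.div_mul_le_self M L
            rw [Nat.add_one_mul] at h₁
            omega
          rintro ⟨w, i⟩ hx ⟨w', i'⟩ hy hxy
          have hi := Finset.mem_range.1 (Finset.mem_product.1 hx).2
          have hi' := Finset.mem_range.1 (Finset.mem_product.1 hy).2
          simp only at hi hi'
          have he : (w : ℕ) * L + i = w' * L + i' :=
            hg.injOn (by simpa using hlt w i hi) (by simpa using hlt w' i' hi') hxy
          have h₁ : ∀ (w : Fin (M / L)) i, i < 3 * s + 4 → (w * L + i) / L = w := by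
            intro w i hi
            exact Nat.div_eq_of_lt_le (by omega) (by rw [Nat.add_one_mul]; omega)
          have hw : w = w' := Fin.ext (by rw [← h₁ w i hi, ← h₁ w' i' hi', he])
          subst hw
          exact Prod.ext rfl (Nat.add_left_cancel he)
      rw [Finset.card_product, Finset.card_range] at hcard
      exact Nat.le_of_mul_le_mul_right (hcard.trans (h.card_induced_le hloop hg hs U))
        (by omega)
  refine ⟨φ, hφ, fun w => ?_⟩
  obtain ⟨i, hi, he⟩ := Finset.mem_image.1 (hmem _)
  exact ⟨i, Finset.mem_range.1 hi, he⟩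

lemma exists_equiv_fin_strictMono [Fintype V] {n : ℕ} (hn : n = Fintype.card V) {τ : V → ℕ}
    (hτ : Function.Injective τ) : ∃ e : Fin n ≃ V, StrictMono fun i => τ (e i) := by
  have hcard : (Finset.univ.image τ).card = n := by
    rw [Finset.card_image_of_injective _ hτ, Finset.card_univ, hn]
  set o := (Finset.univ.image τ).orderEmbOfFin hcard
  have ho : ∀ i, ∃ v, τ v = o i := fun i => by
    obtain ⟨v, -, hv⟩ := Finset.mem_image.1 (Finset.orderEmbOfFin_mem _ hcard i)
    exact ⟨v, hv⟩
  choose e he using ho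
  have hinj : Function.Injective e := fun i j hij => o.injective (by rw [← he, ← he, hij])
  refine ⟨Equiv.ofBijective e ((Fintype.bijective_iff_injective_and_card e).2
    ⟨hinj, by simp [hn]⟩), fun i j hij => ?_⟩
  simpa [he] using hij

/-- Cutting an Eulerian circuit of a minimally Eulerian digraph at one visit `τ v` of each vertex
`v` decomposes it into directed paths joining cyclically consecutive vertices. If every window of
length `L` contains a cut, these paths have length less than `3 L`. -/
lemma MinEuler.exists_paths_of_cuts [Fintype V] {A : Finset (V × V)} (hloop : Loopless A)
    (h : MinEuler A) {n : ℕ} (hn : n = Fintype.card V) (hpos : 0 < n) {M : ℕ} {g : ℕ → V}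
    (hg : IsEulerTour A M g) {τ : V → ℕ} (hτ_lt : ∀ v, τ v < M) (hτ : ∀ v, g (τ v) = v)
    {L : ℕ} (hL : 0 < L) (hwin : ∀ w < M / L, ∃ v, w * L ≤ τ v ∧ τ v < w * L + L) :
    ∃ (e : Fin n ≃ V) (P : Fin n → List V),
      (∀ i : Fin n,
        IsDipathFrom A (e i) (e ⟨(i.val + 1) % n, Nat.mod_lt _ hpos⟩) (P i)) ∧
      (∀ i : Fin n, (P i).length ≤ 3 * L) ∧
      (∀ i j : Fin n, i ≠ j → Disjoint (pathArcs (P i)) (pathArcs (P j))) ∧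
      Finset.univ.biUnion (fun i => pathArcs (P i)) = A := by
  obtain ⟨e, he⟩ := exists_equiv_fin_strictMono hn
    (Function.LeftInverse.injective hτ : Function.Injective τ)
  set q : ℕ → ℕ := fun i => if hi : i < n then τ (e ⟨i, hi⟩) else τ (e ⟨0, hpos⟩) + M
  have hq : ∀ i (hi : i < n), q i = τ (e ⟨i, hi⟩) := fun i hi => dif_pos hi
  have hqn : q n = q 0 + M := by simp [q, hpos]
  have hqM : ∀ i < n, q i < M := fun i hi => by rw [hq i hi]; exact hτ_lt _
  have hqe : ∀ v, ∃ i < n, q i = τ v := fun v =>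
    ⟨e.symm v, (e.symm v).2, by rw [hq _ (e.symm v).2]; simp⟩
  have hq_strict : ∀ i < n, q i < q (i + 1) := by
    intro i hi
    rcases (show i + 1 ≤ n by omega).lt_or_eq with hi' | hi'
    · rw [hq i hi, hq _ hi']
      exact he (Fin.mk_lt_mk.2 (Nat.lt_succ_self i))
    · rw [hi', hqn]
      have := hqM i hi
      omega
  have hq_mono : ∀ i j, i ≤ j → j ≤ n → q i ≤ q j := by
    intro i j hij
    induction j, hij using Nat.le_induction with
    | base => exact fun _ => le_rfl
    | succ j _ ih => exact fun hj => (ih (by omega)).trans (hq_strict j hj).le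
  have hgq : ∀ i (hi : i < n), g (q i) = e ⟨i, hi⟩ := fun i hi => by rw [hq i hi, hτ]
  have hgq' : ∀ i < n, g (q (i + 1)) = e ⟨(i + 1) % n, Nat.mod_lt _ hpos⟩ := by
    intro i hi
    rcases (show i + 1 ≤ n by omega).lt_or_eq with hi' | hi'
    · rw [hgq _ hi']
      simp only [Nat.mod_eq_of_lt hi']
    · rw [hi', hqn, hg.periodic, hgq 0 hpos]
      simp only [Nat.mod_self]
  have hgap : ∀ i < n, q (i + 1) < q i + 3 * L := by
    intro i hi
    have hQ := Nat.div_mul_le_self M L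
    have hQ' := Nat.lt_div_mul_add (a := M) hL
    rcases (show i + 1 ≤ n by omega).lt_or_eq with hi' | hi'
    · by_contra! hlarge
      have h₁ := Nat.div_mul_le_self (q i) L
      have h₂ := Nat.lt_div_mul_add (a := q i) hL
      have h₃ : (q i / L + 1) * L = q i / L * L + L := by ring
      have h₄ := hqM _ hi'
      have h₅ : q i / L + 1 < M / L := by
        rw [← Nat.add_one_le_iff, Nat.le_div_iff_mul_le hL, Nat.add_one_mul]
        omega
      obtain ⟨v, hv₁, hv₂⟩ := hwin _ h₅
      obtain ⟨i', hi'n, hv⟩ := hqe v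
      rcases Nat.lt_or_ge i i' with hlt | hge
      · have := hq_mono (i + 1) i' hlt hi'n.le
        omega
      · have := hq_mono i' i hge hi.le
        omega
    · rw [hi', hqn]
      have h₁ := hqM i hi
      have h₂ := hq_mono 0 i (Nat.zero_le _) hi.le
      rcases Nat.eq_zero_or_pos (M / L) with h₀ | h₀
      · rw [h₀] at hQ'
        omega
      · obtain ⟨v, -, hv⟩ := hwin 0 h₀
        obtain ⟨x, hx, hxv⟩ := hqe v
        have h₃ := hq_mono 0 x (Nat.zero_le _) hx.le
        obtain ⟨v', hv', -⟩ := hwin (M / L - 1) (by omega)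
        obtain ⟨y, hy, hyv⟩ := hqe v'
        have h₄ := hq_mono y i (by omega) hi.le
        have h₅ : M / L * L = (M / L - 1) * L + L := by
          rw [← Nat.add_one_mul, Nat.sub_add_cancel h₀]
        omega
  have hinj : ∀ i < n, Set.InjOn g (Set.Icc (q i) (q (i + 1))) := by
    intro i hi
    refine hg.injOn_segment hloop h.2 fun v => ?_
    obtain ⟨x, hx, hxv⟩ := hqe v
    rcases Nat.lt_or_ge i x with hlt | hge
    · have h₁ := hq_mono (i + 1) x hlt hx.le
      have h₂ := hqM x hx
      exact ⟨τ v, hτ v, by omega, by omega⟩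
    · have h₁ := hq_mono x i hge hi.le
      have h₂ := hq_mono 0 x (Nat.zero_le _) hx.le
      have h₃ := hq_mono (i + 1) n hi le_rfl
      exact ⟨τ v + M, by rw [hg.periodic, hτ v], by omega, by omega⟩
  have hend : ∀ i < n, q i + (q (i + 1) - q i) = q (i + 1) := fun i hi => by
    have := hq_strict i hi
    omega
  have harcs : ∀ i < n, pathArcs (walkSegment g (q i) (q (i + 1) - q i)) =
      (Finset.Ico (q i) (q (i + 1))).image (stepArc g) := fun i hi => by
    rw [pathArcs_walkSegment, hend i hi]
  refine ⟨e, fun i => walkSegment g (q i) (q (i + 1) - q i), ?_, ?_, ?_, ?_⟩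
  · rintro ⟨i, hi⟩
    refine ⟨⟨?_, ?_, ?_⟩, ?_, ?_⟩
    · exact List.ne_nil_of_length_pos (by simp [length_walkSegment])
    · exact nodup_walkSegment _ _ _ (by rw [hend i hi]; exact hinj i hi)
    · exact isChain_walkSegment _ _ _ fun j _ _ => hg.stepArc_mem j
    · rw [head?_walkSegment, hgq i hi]
    · rw [getLast?_walkSegment, hend i hi, hgq' i hi]
  · rintro ⟨i, hi⟩
    rw [length_walkSegment]
    have := hgap i hi
    simp only
    omega
  · have hdisj : ∀ i j, i < j → j < n →
        Disjoint (pathArcs (walkSegment g (q i) (q (i + 1) - q i)))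
          (pathArcs (walkSegment g (q j) (q (j + 1) - q j))) := by
      intro i j hij hj
      rw [harcs i (hij.trans hj), harcs j hj, Finset.disjoint_left]
      intro a ha hb
      obtain ⟨x, hx, rfl⟩ := Finset.mem_image.1 ha
      obtain ⟨y, hy, hxy⟩ := Finset.mem_image.1 hb
      rw [Finset.mem_Ico] at hx hy
      have h₁ := hq_mono 0 i (Nat.zero_le _) (by omega)
      have h₂ := hq_mono (i + 1) j hij hj.le
      have h₃ := hq_mono (j + 1) n hj le_rfl
      have := hg.injOn_Ico (q 0) ⟨by omega, by omega⟩ ⟨by omega, by omega⟩ hxy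
      omega
    rintro ⟨i, hi⟩ ⟨j, hj⟩ hij
    rcases lt_or_gt_of_ne (fun heq => hij (Fin.ext heq) : i ≠ j) with hlt | hlt
    · exact hdisj i j hlt hj
    · exact (hdisj j i hlt hi).symm
  · ext a
    simp only [Finset.mem_biUnion, Finset.mem_univ, true_and]
    constructor
    · rintro ⟨⟨i, hi⟩, ha⟩
      rw [harcs i hi] at ha
      obtain ⟨x, -, rfl⟩ := Finset.mem_image.1 ha
      exact hg.stepArc_mem x
    · intro ha
      rw [← hg.image_Ico (q 0)] at ha
      obtain ⟨t, ht, rfl⟩ := Finset.mem_image.1 ha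
      rw [Finset.mem_Ico, ← hqn] at ht
      have hcover : ∀ m ≤ n, t < q m → ∃ i < m, q i ≤ t ∧ t < q (i + 1) := by
        intro m
        induction m with
        | zero => exact fun _ hlt => absurd hlt (by omega)
        | succ m ih =>
          intro hm hlt
          rcases Nat.lt_or_ge t (q m) with h' | h'
          · obtain ⟨i, hi, hit⟩ := ih (by omega) h'
            exact ⟨i, by omega, hit⟩
          · exact ⟨m, by omega, h', hlt⟩
      obtain ⟨i, hi, hit⟩ := hcover n le_rfl ht.2
      refine ⟨⟨i, hi⟩, ?_⟩
      rw [harcs i hi]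
      exact Finset.mem_image_of_mem _ (Finset.mem_Ico.2 hit)

lemma le_logb_two {a k m : ℕ} {n : ℕ} (hn : m ≤ n) (hm : 0 < m) (hk : 0 < k)
    (h : 2 ^ a ≤ m ^ k) : (a / k : ℝ) ≤ Real.logb 2 n := by
  have hn₀ : (0 : ℝ) < n := by exact_mod_cast hm.trans_le hn
  have h₁ : ((2 : ℝ) ^ a) ≤ (n : ℝ) ^ k := by
    exact_mod_cast h.trans (Nat.pow_le_pow_left hn k)
  have h₂ := Real.logb_le_logb_of_le (b := 2) one_lt_two (by positivity) h₁
  rw [Real.logb_pow, Real.logb_pow, Real.logb_self_eq_one one_lt_two, mul_one] at h₂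
  rw [div_le_iff₀ (by exact_mod_cast hk)]
  linarith

/-- The target bound is trivial for few vertices, and exceeds the bound obtained from windows of
length `3 ⌊√n⌋ + 5` otherwise. -/
lemma min_le_ceil_sqrt_mul_logb_sq {n : ℕ} (hn : 1 < n) :
    min n (3 * (3 * n.sqrt + 5)) ≤ ⌈Real.sqrt n * (Real.logb 2 n) ^ 2 / 2⌉₊ + 1 := by
  set r := Real.sqrt n
  have hr₀ : 0 ≤ r := Real.sqrt_nonneg _
  have hr : r ^ 2 = n := Real.sq_sqrt (Nat.cast_nonneg n)
  have hceil := Nat.le_ceil (r * (Real.logb 2 n) ^ 2 / 2)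
  have hmono : ∀ c : ℝ, 0 ≤ c → c ≤ Real.logb 2 n →
      r * c ^ 2 / 2 ≤ (⌈r * (Real.logb 2 n) ^ 2 / 2⌉₊ : ℝ) := by
    intro c hc hle
    refine le_trans ?_ hceil
    gcongr
  have hsmall : ∀ c : ℝ, 0 ≤ c → c ≤ Real.logb 2 n → r ≤ c ^ 2 / 2 →
      min n (3 * (3 * n.sqrt + 5)) ≤ ⌈r * (Real.logb 2 n) ^ 2 / 2⌉₊ + 1 := by
    intro c hc hle hrc
    refine (min_le_left _ _).trans ?_
    have h₁ := hmono c hc hle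
    have h₂ : r * r ≤ r * (c ^ 2 / 2) := by gcongr
    have h₃ : (n : ℝ) ≤ ⌈r * (Real.logb 2 n) ^ 2 / 2⌉₊ := by nlinarith
    have : n ≤ ⌈r * (Real.logb 2 n) ^ 2 / 2⌉₊ := by exact_mod_cast h₃
    omega
  have hroot : ∀ c : ℝ, 0 ≤ c → (n : ℝ) ≤ c ^ 2 → r ≤ c :=
    fun c hc hnc => Real.sqrt_le_iff.2 ⟨hc, hnc⟩
  have hrange : ∀ m a k : ℕ, 0 < m → 0 < k → 2 ^ a ≤ m ^ k → m ≤ n →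
      (n : ℝ) ≤ ((a / k : ℝ) ^ 2 / 2) ^ 2 →
      min n (3 * (3 * n.sqrt + 5)) ≤ ⌈r * (Real.logb 2 n) ^ 2 / 2⌉₊ + 1 :=
    fun m a k hm hk h hmn hle => hsmall (a / k) (by positivity) (le_logb_two hmn hm hk h)
      (hroot _ (by positivity) hle)
  rcases le_or_gt 64 n with hbig | hlt
  · have hlog := le_logb_two (a := 6) (k := 1) hbig (by norm_num) one_pos (by norm_num)
    have h₁ := hmono _ (by norm_num) hlog
    have h₂ : (n.sqrt : ℝ) ≤ r := Real.nat_sqrt_le_real_sqrt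
    have h₃ : (8 : ℝ) ≤ r := Real.le_sqrt_of_sq_le (by norm_num; exact_mod_cast hbig)
    refine (min_le_right _ _).trans ?_
    have h₄ : ((3 * (3 * n.sqrt + 5) : ℕ) : ℝ) ≤
        ((⌈r * (Real.logb 2 n) ^ 2 / 2⌉₊ + 1 : ℕ) : ℝ) := by
      push_cast at h₁ ⊢
      linarith
    exact_mod_cast h₄
  have hcast : ∀ m : ℕ, n ≤ m → (n : ℝ) ≤ m := fun m hm => by exact_mod_cast hm
  rcases le_or_gt 16 n with h16 | h16
  · exact hrange 16 4 1 (by norm_num) one_pos (by norm_num) h16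
      ((hcast 64 hlt.le).trans (by norm_num))
  rcases le_or_gt 8 n with h8 | h8
  · exact hrange 8 3 1 (by norm_num) one_pos (by norm_num) h8
      ((hcast 16 h16.le).trans (by norm_num))
  rcases le_or_gt 6 n with h6 | h6
  · exact hrange 6 5 2 (by norm_num) two_pos (by norm_num) h6
      ((hcast 8 h8.le).trans (by norm_num))
  rcases le_or_gt 5 n with h5 | h5
  · exact hrange 5 23 10 (by norm_num) (by norm_num) (by norm_num) h5
      ((hcast 6 h6.le).trans (by norm_num))
  rcases le_or_gt 4 n with h4 | h4
  · exact hrange 4 2 1 (by norm_num) one_pos (by norm_num) h4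
      ((hcast 4 (by omega)).trans (by norm_num))
  refine (min_le_left _ _).trans ?_
  have h₁ : (1 : ℝ) ≤ r := Real.le_sqrt_of_sq_le (by norm_num; exact_mod_cast hn.le)
  rcases le_or_gt 3 n with h3 | h3
  · have h₂ := hmono _ (by norm_num)
      (le_logb_two (a := 3) (k := 2) h3 (by norm_num) two_pos (by norm_num))
    have h₃ : (1 : ℝ) < ⌈r * (Real.logb 2 n) ^ 2 / 2⌉₊ := by
      norm_num at h₂
      linarith
    have : 1 < ⌈r * (Real.logb 2 n) ^ 2 / 2⌉₊ := by exact_mod_cast h₃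
    omega
  · have h₂ := hmono _ (by norm_num)
      (le_logb_two (a := 1) (k := 1) hn two_pos one_pos (by norm_num))
    have h₃ : (0 : ℝ) < ⌈r * (Real.logb 2 n) ^ 2 / 2⌉₊ := by
      norm_num at h₂
      linarith
    have : 0 < ⌈r * (Real.logb 2 n) ^ 2 / 2⌉₊ := by exact_mod_cast h₃
    omega

/-- A minimally Eulerian digraph on `n > 1` vertices admits an
ordering `v_1,...,v_n` of its vertices and an edge-disjoint decomposition of
its arcs into `n` directed paths `P_i` from `v_i` to `v_{i+1}` (indices mod
`n`), each of length at most `⌈(1/2)√n log₂² n⌉`. -/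
theorem stmt13 [Fintype V] (A : Finset (V × V)) (hA : Loopless A)
    (h : MinEuler A) (n : ℕ) (hn : n = Fintype.card V) (h1 : 1 < n) :
    ∃ (e : Fin n ≃ V) (P : Fin n → List V),
      (∀ i : Fin n,
        IsDipathFrom A (e i) (e ⟨(i.val + 1) % n, Nat.mod_lt _ (by omega)⟩) (P i)) ∧
      (∀ i : Fin n,
        (P i).length ≤ ⌈Real.sqrt n * (Real.logb 2 n) ^ 2 / 2⌉₊ + 1) ∧
      (∀ i j : Fin n, i ≠ j → Disjoint (pathArcs (P i)) (pathArcs (P j))) ∧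
      Finset.univ.biUnion (fun i => pathArcs (P i)) = A := by
  obtain ⟨u, v, huv⟩ := Fintype.one_lt_card_iff.1 (hn ▸ h1)
  have hne : A.Nonempty := by
    rcases (h.1.1 u v).cases_head with heq | ⟨w, hw, -⟩
    · exact absurd heq huv
    · exact ⟨_, hw⟩
  obtain ⟨M, g, hg⟩ := h.1.exists_tour hne
  set L := 3 * n.sqrt + 5
  obtain ⟨φ, hφ, hwin⟩ := h.exists_window_transversal hA hg (s := n.sqrt) (by
    rw [← hn, sq]
    exact (Nat.lt_succ_sqrt n).le)
  have hτ : ∀ v, ∃ p < M, g p = v ∧ ∀ w, φ w = v → w * L ≤ p ∧ p < w * L + L := by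
    intro v
    by_cases hv : ∃ w, φ w = v
    · obtain ⟨w, rfl⟩ := hv
      obtain ⟨i, hi, he⟩ := hwin w
      refine ⟨w * L + i, ?_, he, fun w' hw' => ?_⟩
      · have h₁ : (w + 1) * L ≤ M / L * L := Nat.mul_le_mul_right L w.2
        have h₂ := Nat.div_mul_le_self M L
        rw [Nat.add_one_mul] at h₁
        omega
      · rw [hφ hw']
        omega
    · obtain ⟨p, hp, hpv⟩ := hg.exists_visit h.1.1 v
      exact ⟨p, hp, hpv, fun w hw => absurd ⟨w, hw⟩ hv⟩
  choose τ hτ_lt hτ_eq hτ_win using hτ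
  obtain ⟨e, P, hpath, hlen, hdisj, hunion⟩ := h.exists_paths_of_cuts hA hn (by omega) hg hτ_lt
    hτ_eq (L := L) (by omega) fun w hw => ⟨φ ⟨w, hw⟩, hτ_win _ ⟨w, hw⟩ rfl⟩
  refine ⟨e, P, hpath, fun i => ?_, hdisj, hunion⟩
  refine le_trans (le_min ?_ (hlen i)) (min_le_ceil_sqrt_mul_logb_sq h1)
  rw [hn]
  exact (hpath i).1.2.1.length_le_card
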